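/- arXiv:1303.5113 — 2 statements merged into one kernel-verified Lean document; each statement's English description precedes it below -/
import Mathlib

section
/- Let K₁, K₂ be compactly supported functions on ℝ^d, smooth away from 0, of orders ζ₁ and ζ₂ with ζ₁ ∧ ζ₂ > -|s| and ζ̄ := ζ₁ + ζ₂ + |s| < 0. Then the convolution K₁ * K₂ is of order ζ̄, and for every m one has ⦀K₁ * K₂⦀_{ζ̄;m} ≤ C ⦀K₁⦀_{ζ₁;m} ⦀K₂⦀_{ζ₂;m} for a constant C depending only on the supports. -/
open MeasureTheory

/-- The scaled norm `‖x‖_s = ∑_i |x_i|^{1/s_i}` on `ℝ^d`. -/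
noncomputable def sNorm {d : ℕ} (s : Fin d → ℕ) (x : Fin d → ℝ) : ℝ :=
  ∑ i, |x i| ^ ((s i : ℝ)⁻¹)

/-- The scaled degree `|k|_s = ∑ s_i k_i` of a multiindex, encoded as a list of directions. -/
def sdeg {d : ℕ} (s : Fin d → ℕ) (ℓ : List (Fin d)) : ℕ := (ℓ.map s).sum

/-- Iterated partial derivative `D^ℓ f` along the list of coordinate directions `ℓ`. -/
noncomputable def mderiv {d : ℕ} : List (Fin d) → ((Fin d → ℝ) → ℝ) → (Fin d → ℝ) → ℝ
  | [], f => f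
  | i :: ℓ, f => fun x => fderiv ℝ (mderiv ℓ f) x (Pi.single i 1)

open Filter Topology

theorem mderiv_congr {d : ℕ} (ℓ : List (Fin d)) {f g : (Fin d → ℝ) → ℝ} {x : Fin d → ℝ}
    (h : f =ᶠ[𝓝 x] g) : mderiv ℓ f =ᶠ[𝓝 x] mderiv ℓ g := by
  induction ℓ with
  | nil => exact h
  | cons i ℓ ih =>
    filter_upwards [ih.fderiv (𝕜 := ℝ)] with y hy
    simp only [mderiv, hy]

theorem mderiv_smooth {d : ℕ} (ℓ : List (Fin d)) {f : (Fin d → ℝ) → ℝ} {x : Fin d → ℝ}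
    (h : ContDiffAt ℝ (⊤ : ℕ∞) f x) : ContDiffAt ℝ (⊤ : ℕ∞) (mderiv ℓ f) x := by
  induction ℓ with
  | nil => exact h
  | cons i ℓ ih =>
    have : ContDiffAt ℝ (⊤ : ℕ∞) (fderiv ℝ (mderiv ℓ f)) x := ih.fderiv_right (by simp)
    exact this.clm_apply contDiffAt_const

theorem ev_diff {d : ℕ} {f : (Fin d → ℝ) → ℝ} {x : Fin d → ℝ}
    (h : ContDiffAt ℝ (⊤ : ℕ∞) f x) : ∀ᶠ y in 𝓝 x, DifferentiableAt ℝ f y := by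
  have h1 : ContDiffAt ℝ 1 f x := h.of_le (by exact_mod_cast le_top)
  filter_upwards [h1.eventually (by simp)] with y hy
  exact hy.differentiableAt (by simp)

theorem mderiv_add_ev {d : ℕ} (ℓ : List (Fin d)) {f g : (Fin d → ℝ) → ℝ} {x : Fin d → ℝ}
    (hf : ContDiffAt ℝ (⊤ : ℕ∞) f x) (hg : ContDiffAt ℝ (⊤ : ℕ∞) g x) :
    mderiv ℓ (fun y => f y + g y) =ᶠ[𝓝 x] fun y => mderiv ℓ f y + mderiv ℓ g y := by
  induction ℓ with
  | nil => exact EventuallyEq.rfl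
  | cons i ℓ ih =>
    filter_upwards [ih.fderiv (𝕜 := ℝ), ev_diff (mderiv_smooth ℓ hf), ev_diff (mderiv_smooth ℓ hg)]
      with y hy h1 h2
    simp only [mderiv, hy]
    rw [fderiv_fun_add h1 h2]; rfl

theorem mderiv_const_mul {d : ℕ} (ℓ : List (Fin d)) (c : ℝ) (f : (Fin d → ℝ) → ℝ) :
    mderiv ℓ (fun y => c * f y) = fun y => c * mderiv ℓ f y := by
  induction ℓ with
  | nil => rfl
  | cons i ℓ ih =>
    funext y
    simp only [mderiv, ih]
    have := congrFun (fderiv_const_smul_field (𝕜 := ℝ) (f := mderiv ℓ f) c) y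
    have h2 : (fun y => c * mderiv ℓ f y) = c • mderiv ℓ f := rfl
    rw [h2, this]; rfl

theorem mderiv_snoc {d : ℕ} (ℓ : List (Fin d)) (i : Fin d) (f : (Fin d → ℝ) → ℝ) :
    mderiv (ℓ ++ [i]) f = mderiv ℓ (mderiv [i] f) := by
  induction ℓ with
  | nil => rfl
  | cons j ℓ ih => 
    simp only [List.cons_append, mderiv] at ih ⊢
    rw [ih]

theorem mderiv_comp {d : ℕ} (ℓ : List (Fin d)) (f : (Fin d → ℝ) → ℝ)
    (S : (Fin d → ℝ) ≃L[ℝ] (Fin d → ℝ)) (c : Fin d → ℝ)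
    (hS : ∀ i, S (Pi.single i 1) = c i • Pi.single i 1) (x : Fin d → ℝ) :
    mderiv ℓ (fun y => f (S y)) x = (ℓ.map c).prod * mderiv ℓ f (S x) := by
  induction ℓ generalizing x with
  | nil => simp [mderiv]
  | cons i ℓ ih =>
    have e : mderiv ℓ (fun y => f (S y)) = fun y => (ℓ.map c).prod * (mderiv ℓ f ∘ S) y := 
      funext ih
    simp only [mderiv, e]
    have := congrFun (fderiv_const_smul_field (𝕜 := ℝ) (f := mderiv ℓ f ∘ S) (ℓ.map c).prod) x
    have h2 : (fun y => (ℓ.map c).prod * (mderiv ℓ f ∘ S) y)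
      = (ℓ.map c).prod • (mderiv ℓ f ∘ S) := rfl
    rw [h2, this]
    simp only [Pi.smul_apply, _root_.smul_apply]
    rw [S.comp_right_fderiv]
    simp only [ContinuousLinearMap.comp_apply, ContinuousLinearEquiv.coe_coe, hS, map_smul,
      smul_eq_mul, List.map_cons, List.prod_cons]
    ring

theorem leibniz {d : ℕ} (ℓ : List (Fin d)) : ∀ (f g : (Fin d → ℝ) → ℝ) (x : Fin d → ℝ) (P M : ℝ),
    ContDiffAt ℝ (⊤ : ℕ∞) f x → ContDiffAt ℝ (⊤ : ℕ∞) g x →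
    (∀ a, a.Sublist ℓ → |mderiv a f x| ≤ P) → (∀ a, a.Sublist ℓ → |mderiv a g x| ≤ M) →
    |mderiv ℓ (fun y => f y * g y) x| ≤ 2 ^ ℓ.length * (P * M) := by
  induction ℓ using List.reverseRecOn with
  | nil =>
    intro f g x P M hf hg h1 h2
    have h1 := h1 [] (List.Sublist.refl _)
    have h2 := h2 [] (List.Sublist.refl _)
    simp only [mderiv, abs_mul, List.length_nil, pow_zero, one_mul] at *
    exact mul_le_mul h1 h2 (abs_nonneg _) ((abs_nonneg _).trans h1)
  | append_singleton ℓ i ih =>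
    intro f g x P M hf hg h1 h2
    rw [mderiv_snoc]
    have e : mderiv [i] (fun y => f y * g y) =ᶠ[𝓝 x]
        fun y => mderiv [i] f y * g y + f y * mderiv [i] g y := by
      filter_upwards [ev_diff hf, ev_diff hg] with y hy1 hy2
      simp only [mderiv]
      rw [fderiv_fun_mul hy1 hy2]
      simp; ring
    rw [(mderiv_congr ℓ e).eq_of_nhds]
    have hf' := mderiv_smooth [i] hf
    have hg' := mderiv_smooth [i] hg
    rw [(mderiv_add_ev ℓ (hf'.mul hg) (hf.mul hg')).eq_of_nhds]
    have s0 : ∀ a : List (Fin d), a.Sublist ℓ → a.Sublist (ℓ ++ [i]) := fun a ha =>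
      ha.trans (List.sublist_append_left _ _)
    have s1 : ∀ a : List (Fin d), a.Sublist ℓ → (a ++ [i]).Sublist (ℓ ++ [i]) := fun a ha =>
      ha.append_right _
    have b1 := ih (mderiv [i] f) g x P M hf' hg
      (fun a ha => by rw [← mderiv_snoc]; exact h1 _ (s1 a ha)) (fun a ha => h2 _ (s0 a ha))
    have b2 := ih f (mderiv [i] g) x P M hf hg'
      (fun a ha => h1 _ (s0 a ha)) (fun a ha => by rw [← mderiv_snoc]; exact h2 _ (s1 a ha))
    refine (abs_add_le _ _).trans ((add_le_add b1 b2).trans (le_of_eq ?_))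
    simp [pow_succ]; ring

theorem mderiv_contDiff {d : ℕ} (ℓ : List (Fin d)) {g : (Fin d → ℝ) → ℝ}
    (h : ContDiff ℝ (⊤ : ℕ∞) g) : ContDiff ℝ (⊤ : ℕ∞) (mderiv ℓ g) :=
  contDiff_iff_contDiffAt.2 fun _ => mderiv_smooth ℓ h.contDiffAt

theorem mderiv_cpt {d : ℕ} (ℓ : List (Fin d)) {g : (Fin d → ℝ) → ℝ}
    (h : HasCompactSupport g) : HasCompactSupport (mderiv ℓ g) := by
  induction ℓ with
  | nil => exact h
  | cons i ℓ ih => exact (ih.fderiv_apply (𝕜 := ℝ) (Pi.single i 1))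

theorem mderiv_conv {d : ℕ} (ℓ : List (Fin d)) {f g : (Fin d → ℝ) → ℝ}
    (hf : LocallyIntegrable f) (hg : ContDiff ℝ (⊤ : ℕ∞) g) (hc : HasCompactSupport g) :
    mderiv ℓ (fun z => ∫ t, f t * g (z - t)) = fun z => ∫ t, f t * mderiv ℓ g (z - t) := by
  induction ℓ with
  | nil => rfl
  | cons i ℓ ih =>
    funext x
    simp only [mderiv, ih]
    have hg1 : ContDiff ℝ 1 (mderiv ℓ g) := (mderiv_contDiff ℓ hg).of_le (by exact_mod_cast le_top)
    have hc1 := mderiv_cpt ℓ hc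
    have key := (hc1.hasFDerivAt_convolution_right (ContinuousLinearMap.mul ℝ ℝ) hf hg1 x).fderiv
    have e : (fun z => ∫ t, f t * mderiv ℓ g (z - t))
       = MeasureTheory.convolution f (mderiv ℓ g) (ContinuousLinearMap.mul ℝ ℝ) volume := rfl
    rw [e, key]
    unfold MeasureTheory.convolution
    have hI : Integrable (fun t => ((ContinuousLinearMap.mul ℝ ℝ).precompR (Fin d → ℝ)) (f t)
        (fderiv ℝ (mderiv ℓ g) (x - t))) := by
      have := (hc1.fderiv ℝ).convolutionExists_right
        ((ContinuousLinearMap.mul ℝ ℝ).precompR (Fin d → ℝ)) hf (hg1.continuous_fderiv (by simp)) x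
      exact this
    rw [ContinuousLinearMap.integral_apply hI]
    rfl

section sn
variable {d : ℕ} (s : Fin d → ℕ)

theorem sNorm_nonneg (x : Fin d → ℝ) : 0 ≤ sNorm s x :=
  Finset.sum_nonneg fun i _ => Real.rpow_nonneg (abs_nonneg _) _

theorem sNorm_cont (hs : ∀ i, 0 < s i) : Continuous (sNorm s) := by
  unfold sNorm
  refine continuous_finsetSum _ fun i _ => ?_
  exact (continuous_abs.comp (continuous_apply i)).rpow_const (fun _ => Or.inr (by positivity))

theorem sNorm_zero (hs : ∀ i, 0 < s i) : sNorm s 0 = 0 := by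
  unfold sNorm
  refine Finset.sum_eq_zero fun i _ => ?_
  have := hs i
  simp only [Pi.zero_apply, abs_zero]
  exact Real.zero_rpow (by positivity)

theorem abs_le_sNorm (hs : ∀ i, 0 < s i) (x : Fin d → ℝ) (i : Fin d) :
    |x i| ≤ sNorm s x ^ (s i) := by
  have h : |x i| ^ ((s i : ℝ)⁻¹) ≤ sNorm s x :=
    Finset.single_le_sum (f := fun i => |x i| ^ ((s i : ℝ)⁻¹))
      (fun i _ => Real.rpow_nonneg (abs_nonneg _) _) (Finset.mem_univ i)
  have := pow_le_pow_left₀ (Real.rpow_nonneg (abs_nonneg _) _) h (s i)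
  rwa [Real.rpow_inv_natCast_pow (abs_nonneg _) (hs i).ne'] at this

theorem sNorm_pos (hs : ∀ i, 0 < s i) {x : Fin d → ℝ} (hx : x ≠ 0) : 0 < sNorm s x := by
  refine (sNorm_nonneg s x).lt_of_ne' fun h => hx ?_
  funext i
  have := abs_le_sNorm s hs x i
  rw [h, zero_pow (hs i).ne'] at this
  simpa using this

theorem sNorm_add (hs : ∀ i, 0 < s i) (x y : Fin d → ℝ) :
    sNorm s (x + y) ≤ sNorm s x + sNorm s y := by
  unfold sNorm
  rw [← Finset.sum_add_distrib]
  refine Finset.sum_le_sum fun i _ => ?_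
  have h1 : (1 : ℝ) ≤ s i := by exact_mod_cast hs i
  calc |(x + y) i| ^ ((s i : ℝ)⁻¹) ≤ (|x i| + |y i|) ^ ((s i : ℝ)⁻¹) :=
        Real.rpow_le_rpow (abs_nonneg _) (abs_add_le _ _) (by positivity)
    _ ≤ _ := Real.rpow_add_le_add_rpow (abs_nonneg _) (abs_nonneg _) (by positivity)
        (inv_le_one_of_one_le₀ h1)

theorem norm_le_sNorm (hs : ∀ i, 0 < s i) {x : Fin d → ℝ} (h : sNorm s x ≤ 1) :
    ‖x‖ ≤ sNorm s x := by
  refine (pi_norm_le_iff_of_nonneg (sNorm_nonneg s x)).2 fun i => ?_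
  exact (abs_le_sNorm s hs x i).trans (pow_le_of_le_one (sNorm_nonneg s x) h (hs i).ne')

theorem prod_sNorm (x : ℝ) : ∏ i, x ^ (s i) = x ^ (∑ i, s i) :=
  Finset.prod_pow_eq_pow_sum _ _ _

theorem J1 (hs : ∀ i, 0 < s i) (hd : 0 < d) {ζ : ℝ} (h : -(∑ i, (s i : ℝ)) < ζ) (h0 : ζ ≤ 0) (R : ℝ) :
    IntegrableOn (fun x => sNorm s x ^ ζ) {x | sNorm s x ≤ R} := by
  have : Nonempty (Fin d) := ⟨⟨0, hd⟩⟩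
  set σ : ℝ := ∑ i, (s i : ℝ) with hσ
  have hσ0 : 0 < σ := Finset.sum_pos (fun i _ => by exact_mod_cast hs i) Finset.univ_nonempty
  set T : ℝ := (max R 1) ^ (∑ i, s i)
  have hT0 : 0 ≤ T := by positivity
  set p := ζ / σ
  have hp : -1 < p := by rw [lt_div_iff₀ hσ0]; linarith
  have hp0 : p ≤ 0 := div_nonpos_of_nonpos_of_nonneg h0 hσ0.le
  have hI : Integrable (fun t : ℝ => (Set.Icc (-T) T).indicator (fun t => |t| ^ p) t) := by
    rw [integrable_indicator_iff measurableSet_Icc]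
    have a1 : IntervalIntegrable (fun t : ℝ => |t| ^ p) volume 0 T :=
      (intervalIntegral.intervalIntegrable_rpow' hp).congr (by
        intro t ht
        rw [Set.uIoc_of_le hT0] at ht
        simp only [abs_of_pos ht.1])
    have a2 : IntervalIntegrable (fun t : ℝ => |t| ^ p) volume (-T) 0 := by
      have := (IntervalIntegrable.iff_comp_neg (by simp)).1 a1
      simpa using this.symm
    have := a2.trans a1
    rwa [intervalIntegrable_iff_integrableOn_Icc_of_le (by linarith)] at this
  have hP : Integrable (fun x : Fin d → ℝ =>
      ∏ i, (Set.Icc (-T) T).indicator (fun t => |t| ^ p) (x i)) :=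
    Integrable.fintype_prod (fun _ => hI)
  have hmeas : MeasurableSet {x | sNorm s x ≤ R} :=
    ((sNorm_cont s hs).measurable measurableSet_Iic)
  refine hP.integrableOn.mono' ((sNorm_cont s hs).measurable.pow_const ζ).aestronglyMeasurable ?_
  have hae : ∀ᵐ x : Fin d → ℝ, ∀ i, x i ≠ 0 := by
    refine ae_all_iff.2 fun i => ?_
    have : (volume : Measure (Fin d → ℝ)) {x | x i = 0} = 0 := by
      exact Measure.pi_hyperplane (fun _ : Fin d => (volume : Measure ℝ)) i 0
    rw [ae_iff]
    simpa using this
  rw [ae_restrict_iff' hmeas]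
  filter_upwards [hae] with x hx hxR
  have hR : sNorm s x ≤ R := hxR
  have hb : ∀ i, x i ∈ Set.Icc (-T) T := fun i => by
    refine abs_le.1 ?_
    refine (abs_le_sNorm s hs x i).trans ?_
    refine (pow_le_pow_left₀ (sNorm_nonneg s x) (hR.trans (le_max_left R 1)) _).trans ?_
    exact pow_le_pow_right₀ (le_max_right R 1)
      (Finset.single_le_sum (f := s) (fun _ _ => Nat.zero_le _) (Finset.mem_univ i))
  rw [Finset.prod_congr rfl fun i _ => Set.indicator_of_mem (hb i) _]
  rw [Real.norm_of_nonneg (Real.rpow_nonneg (sNorm_nonneg s x) _),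
    Real.finsetProd_rpow _ _ (fun i _ => abs_nonneg _)]
  have e : sNorm s x ^ ζ = (sNorm s x ^ σ) ^ p := by
    rw [← Real.rpow_mul (sNorm_nonneg s x)]
    congr 1; simp only [p]; field_simp
  rw [e]
  refine Real.rpow_le_rpow_of_nonpos (Finset.prod_pos fun i _ => abs_pos.2 (hx i)) ?_ hp0
  have e2 : sNorm s x ^ σ = sNorm s x ^ (∑ i, s i) := by
    rw [← Real.rpow_natCast]; simp [hσ]
  rw [e2, ← prod_sNorm]
  exact Finset.prod_le_prod (fun _ _ => abs_nonneg _) fun i _ => abs_le_sNorm s hs x i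

theorem J2 (hs : ∀ i, 0 < s i) (hd : 0 < d) {ζ : ℝ} (h : ζ < -(∑ i, (s i : ℝ))) :
    IntegrableOn (fun x => sNorm s x ^ ζ) {x | 1 / 2 < sNorm s x} := by
  have : Nonempty (Fin d) := ⟨⟨0, hd⟩⟩
  set σ : ℝ := ∑ i, (s i : ℝ) with hσ
  have hσ0 : 0 < σ := Finset.sum_pos (fun i _ => by exact_mod_cast hs i) Finset.univ_nonempty
  set p := ζ / σ
  have hp : p < -1 := by rw [div_lt_iff₀ hσ0]; linarith
  have hI : Integrable (fun t : ℝ => (1 + ‖t‖) ^ p) := by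
    have := integrable_one_add_norm (E := ℝ) (μ := volume) (r := -p) (by simp; linarith)
    simpa using this
  have hP : Integrable (fun x : Fin d → ℝ => ∏ i, (1 + ‖x i‖) ^ p) :=
    Integrable.fintype_prod (fun _ => hI)
  have hmeas : MeasurableSet {x | 1 / 2 < sNorm s x} :=
    ((sNorm_cont s hs).measurable measurableSet_Ioi)
  set c : ℝ := (∏ i : Fin d, (2 : ℝ) * 2 ^ (s i)) with hc
  have hc0 : 0 < c := Finset.prod_pos fun i _ => by positivity
  refine (hP.const_mul ((c⁻¹) ^ p)).integrableOn.mono'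
    ((sNorm_cont s hs).measurable.pow_const ζ).aestronglyMeasurable ?_
  rw [ae_restrict_iff' hmeas]
  filter_upwards with x hxR
  have hR : 1 / 2 < sNorm s x := hxR
  have hn := sNorm_nonneg s x
  rw [Real.norm_of_nonneg (Real.rpow_nonneg hn _),
    Real.finsetProd_rpow _ _ (fun i _ => by positivity),
    ← Real.mul_rpow (by positivity) (Finset.prod_nonneg fun i _ => by positivity)]
  have e : sNorm s x ^ ζ = (sNorm s x ^ σ) ^ p := by
    rw [← Real.rpow_mul hn]
    congr 1; simp only [p]; field_simp
  rw [e]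
  refine Real.rpow_le_rpow_of_nonpos
    (mul_pos (by positivity) (Finset.prod_pos fun i _ => by positivity)) ?_ (by linarith)
  have e2 : sNorm s x ^ σ = sNorm s x ^ (∑ i, s i) := by
    rw [← Real.rpow_natCast]; simp [hσ]
  rw [e2, ← prod_sNorm, inv_mul_le_iff₀ hc0, hc, ← Finset.prod_mul_distrib]
  refine Finset.prod_le_prod (fun _ _ => by positivity) fun i _ => ?_
  have b1 := abs_le_sNorm s hs x i
  have b2 : 1 ≤ (2 * sNorm s x) ^ (s i) := one_le_pow₀ (by linarith)
  have b3 : sNorm s x ^ (s i) ≤ (2 * sNorm s x) ^ (s i) :=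
    pow_le_pow_left₀ hn (by linarith) _
  rw [mul_pow] at b2 b3
  rw [Real.norm_eq_abs]
  linarith

theorem Ibound (hs : ∀ i, 0 < s i) (hd : 0 < d) {ζ₁ ζ₂ : ℝ}
    (h1 : -(∑ i, (s i : ℝ)) < ζ₁) (h1' : -(∑ i, (s i : ℝ)) < ζ₂)
    (h2 : ζ₁ + ζ₂ + (∑ i, (s i : ℝ)) < 0) :
    ∃ C : ℝ, 0 ≤ C ∧ ∀ x, sNorm s x = 1 →
      Integrable (fun y => sNorm s (x - y) ^ ζ₁ * sNorm s y ^ ζ₂) ∧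
      ∫ y, sNorm s (x - y) ^ ζ₁ * sNorm s y ^ ζ₂ ≤ C := by
  have hz1 : ζ₁ < 0 := by linarith
  have hz2 : ζ₂ < 0 := by linarith
  have hm := (sNorm_cont s hs).measurable
  have m1 : MeasurableSet {x | sNorm s x ≤ 1 / 2} := hm measurableSet_Iic
  have m2 : MeasurableSet {x | 1 / 2 < sNorm s x} := hm measurableSet_Ioi
  set F : ℝ → (Fin d → ℝ) → ℝ := fun ζ => {x | sNorm s x ≤ 1 / 2}.indicator (fun x => sNorm s x ^ ζ)
  set G : (Fin d → ℝ) → ℝ := {x | 1 / 2 < sNorm s x}.indicator (fun x => sNorm s x ^ (ζ₁ + ζ₂))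
  have hF1 : Integrable (F ζ₁) := (integrable_indicator_iff m1).2 (J1 s hs hd h1 hz1.le _)
  have hF2 : Integrable (F ζ₂) := (integrable_indicator_iff m1).2 (J1 s hs hd h1' hz2.le _)
  have hG : Integrable G := (integrable_indicator_iff m2).2 (J2 s hs hd (by linarith))
  have F0 : ∀ ζ x, 0 ≤ F ζ x := fun ζ x =>
    Set.indicator_nonneg (fun x _ => Real.rpow_nonneg (sNorm_nonneg s x) _) x
  have G0 : ∀ x, 0 ≤ G x := fun x =>
    Set.indicator_nonneg (fun x _ => Real.rpow_nonneg (sNorm_nonneg s x) _) x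
  set A : ℝ := (1 / 2 : ℝ) ^ ζ₁
  set B : ℝ := (1 / 2 : ℝ) ^ ζ₂
  have A0 : 0 ≤ A := by positivity
  have B0 : 0 ≤ B := by positivity
  refine ⟨A * (∫ y, F ζ₂ y) + B * (∫ y, F ζ₁ y) + (∫ y, G y) + ∫ y, G y, ?_, ?_⟩
  · have := integral_nonneg (μ := volume) (f := F ζ₁) (F0 ζ₁)
    have := integral_nonneg (μ := volume) (f := F ζ₂) (F0 ζ₂)
    have := integral_nonneg (μ := volume) (f := G) G0
    positivity
  intro x hx
  have key : ∀ y, sNorm s (x - y) ^ ζ₁ * sNorm s y ^ ζ₂ ≤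
      A * F ζ₂ y + B * F ζ₁ (x - y) + G (x - y) + G y := by
    intro y
    have tri : 1 ≤ sNorm s (x - y) + sNorm s y := by
      have := sNorm_add s hs (x - y) y
      rwa [sub_add_cancel, hx] at this
    have a0 := sNorm_nonneg s (x - y)
    have b0 := sNorm_nonneg s y
    have pA1 := mul_nonneg A0 (F0 ζ₂ y)
    have pB1 := mul_nonneg B0 (F0 ζ₁ (x - y))
    have g1 := G0 (x - y)
    have g2 := G0 y
    rcases le_or_gt (sNorm s y) (1 / 2) with hb | hb
    · have e : F ζ₂ y = sNorm s y ^ ζ₂ := Set.indicator_of_mem (s := {x | sNorm s x ≤ 1 / 2}) hb _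
      have : sNorm s (x - y) ^ ζ₁ ≤ A :=
        Real.rpow_le_rpow_of_nonpos (by norm_num) (by linarith) hz1.le
      have := mul_le_mul_of_nonneg_right this (Real.rpow_nonneg b0 ζ₂)
      rw [← e] at this ⊢
      linarith
    rcases le_or_gt (sNorm s (x - y)) (1 / 2) with ha | ha
    · have e : F ζ₁ (x - y) = sNorm s (x - y) ^ ζ₁ :=
        Set.indicator_of_mem (s := {x | sNorm s x ≤ 1 / 2}) ha _
      have : sNorm s y ^ ζ₂ ≤ B :=
        Real.rpow_le_rpow_of_nonpos (by norm_num) hb.le hz2.le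
      have := mul_le_mul_of_nonneg_left this (Real.rpow_nonneg a0 ζ₁)
      rw [← e] at this ⊢
      linarith
    have e1 : G y = sNorm s y ^ (ζ₁ + ζ₂) :=
      Set.indicator_of_mem (s := {x | 1 / 2 < sNorm s x}) hb _
    have e2 : G (x - y) = sNorm s (x - y) ^ (ζ₁ + ζ₂) :=
      Set.indicator_of_mem (s := {x | 1 / 2 < sNorm s x}) ha _
    have a1 : 0 < sNorm s (x - y) := by linarith
    have b1 : 0 < sNorm s y := by linarith
    rcases le_total (sNorm s (x - y)) (sNorm s y) with hab | hab
    · have := Real.rpow_le_rpow_of_nonpos a1 hab hz2.le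
      have := mul_le_mul_of_nonneg_left this (Real.rpow_nonneg a0 ζ₁)
      rw [← Real.rpow_add a1, ← e2] at this
      linarith
    · have := Real.rpow_le_rpow_of_nonpos b1 hab hz1.le
      have := mul_le_mul_of_nonneg_right this (Real.rpow_nonneg b0 ζ₂)
      rw [← Real.rpow_add b1, ← e1] at this
      linarith
  have i1 := hF2.const_mul A
  have i2 := (hF1.comp_sub_left x).const_mul B
  have i3 := hG.comp_sub_left x
  have i12 : Integrable (fun y => A * F ζ₂ y + B * F ζ₁ (x - y)) := i1.add i2
  have i123 : Integrable (fun y => A * F ζ₂ y + B * F ζ₁ (x - y) + G (x - y)) := i12.add i3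
  have iall : Integrable (fun y => A * F ζ₂ y + B * F ζ₁ (x - y) + G (x - y) + G y) :=
    i123.add hG
  have hI : Integrable (fun y => sNorm s (x - y) ^ ζ₁ * sNorm s y ^ ζ₂) := by
    refine iall.mono' ?_ (ae_of_all _ fun y => ?_)
    · exact (((hm.comp (measurable_const.sub measurable_id)).pow_const ζ₁).mul
        (hm.pow_const ζ₂)).aestronglyMeasurable
    · rw [Real.norm_of_nonneg (mul_nonneg (Real.rpow_nonneg (sNorm_nonneg s _) _)
        (Real.rpow_nonneg (sNorm_nonneg s _) _))]
      exact key y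
  refine ⟨hI, (integral_mono hI iall key).trans (le_of_eq ?_)⟩
  rw [integral_add i123 hG, integral_add i12 i3, integral_add i1 i2, integral_const_mul,
    integral_const_mul, integral_sub_left_eq_self (F ζ₁) volume x,
    integral_sub_left_eq_self G volume x]

end sn

section main
variable {d : ℕ} (s : Fin d → ℕ)

/-- The hypotheses on a kernel, bundled. -/
def Ker (ζ : ℝ) (n : ℕ) (R : ℝ) (K : (Fin d → ℝ) → ℝ) (N : ℝ) : Prop :=
  ContDiffOn ℝ (⊤ : ℕ∞) K {x | x ≠ 0} ∧ (∀ x : Fin d → ℝ, R < sNorm s x → K x = 0) ∧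
  (∀ ℓ : List (Fin d), sdeg s ℓ ≤ n → ∀ x : Fin d → ℝ, x ≠ 0 →
        |mderiv ℓ K x| ≤ N * sNorm s x ^ (ζ - (sdeg s ℓ : ℝ)))

theorem kernel_integrable (hs : ∀ i, 0 < s i) (hd : 0 < d) {ζ : ℝ}
    (h : -(∑ i, (s i : ℝ)) < ζ) (h0 : ζ ≤ 0) {R N : ℝ} {K : (Fin d → ℝ) → ℝ}
    (hK : ContinuousOn K {x | x ≠ 0}) (hR : ∀ x : Fin d → ℝ, R < sNorm s x → K x = 0)
    (hN : ∀ x, x ≠ 0 → |K x| ≤ N * sNorm s x ^ ζ) : Integrable K := by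
  have : Nonempty (Fin d) := ⟨⟨0, hd⟩⟩
  have hae : ∀ᵐ x : Fin d → ℝ, x ≠ 0 := by
    rw [ae_iff]; simp
  have hres : (volume : Measure (Fin d → ℝ)).restrict {x | x ≠ 0} = volume :=
    Measure.restrict_eq_self_of_ae_mem hae
  have hopen : IsOpen {x : Fin d → ℝ | x ≠ 0} := isOpen_ne
  have hmeas : AEStronglyMeasurable K volume := by
    rw [← hres]; exact hK.aestronglyMeasurable hopen.measurableSet
  have m1 : MeasurableSet {x | sNorm s x ≤ R} := (sNorm_cont s hs).measurable measurableSet_Iic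
  have hI := ((integrable_indicator_iff m1).2 (J1 s hs hd h h0 R)).const_mul N
  refine hI.mono' hmeas ?_
  filter_upwards [hae] with x hx
  by_cases hxR : sNorm s x ≤ R
  · rw [Set.indicator_of_mem (s := {x | sNorm s x ≤ R}) hxR]
    exact hN x hx
  · rw [hR x (not_le.1 hxR)]
    rw [Set.indicator_of_notMem (s := {x | sNorm s x ≤ R}) hxR]
    simp

theorem sdeg_sublist {a ℓ : List (Fin d)} (h : a.Sublist ℓ) : sdeg s a ≤ sdeg s ℓ :=
  (h.map s).sum_le_sum (by simp)

theorem mderiv_zero (ℓ : List (Fin d)) (x : Fin d → ℝ) : mderiv ℓ (fun _ => (0 : ℝ)) x = 0 := by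
  have := congrFun (mderiv_const_mul ℓ 0 (fun _ => (0 : ℝ))) x
  simpa using this

theorem Bprop (hs : ∀ i, 0 < s i) (χ : ContDiffBump (0 : Fin d → ℝ)) (hχ : χ.rIn ≤ 1)
    (ℓ : List (Fin d)) (ζ : ℝ) :
    ∃ D : ℝ, 0 ≤ D ∧ ∀ K N R, 0 ≤ N → Ker s ζ (sdeg s ℓ) R K N →
      ContDiff ℝ (⊤ : ℕ∞) (fun y => (1 - χ y) * K y) ∧
      HasCompactSupport (fun y => (1 - χ y) * K y) ∧
      ∀ y, y ≠ 0 → |mderiv ℓ (fun y => (1 - χ y) * K y) y| ≤ D * N * sNorm s y ^ ζ := by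
  classical
  have hχs : ContDiff ℝ (⊤ : ℕ∞) (χ : (Fin d → ℝ) → ℝ) := χ.contDiff
  have hPa : ∀ a : List (Fin d), ∃ P, ∀ x, ‖mderiv a χ x‖ ≤ P := fun a =>
    (mderiv_cpt a χ.hasCompactSupport).exists_bound_of_continuous (mderiv_contDiff a hχs).continuous
  choose Pa hPa using hPa
  have Pa0 : ∀ a, 0 ≤ Pa a := fun a => (norm_nonneg _).trans (hPa a 0)
  set P := ∑ a ∈ ℓ.sublists.toFinset, Pa a with hP
  have hP0 : 0 ≤ P := Finset.sum_nonneg fun a _ => Pa0 a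
  have hPb : ∀ a, a.Sublist ℓ → ∀ x, |mderiv a χ x| ≤ P := fun a ha x =>
    (hPa a x).trans (Finset.single_le_sum (f := Pa) (fun a _ => Pa0 a) (by simpa using ha))
  set c := χ.rIn with hc
  have hc0 : 0 < c := χ.rIn_pos
  set n := sdeg s ℓ with hn
  set Q : ℝ := c ^ (-(n : ℝ)) with hQ
  have hQ0 : 0 ≤ Q := by positivity
  refine ⟨(1 + 2 ^ ℓ.length * P) * Q, by positivity, ?_⟩
  intro K N R hN0 ⟨hsm, hR, hN⟩
  have hKat : ∀ y, y ≠ 0 → ContDiffAt ℝ (⊤ : ℕ∞) K y := fun y hy =>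
    hsm.contDiffAt (isOpen_ne.mem_nhds hy)
  have hz : ∀ y : Fin d → ℝ, ‖y‖ < c → (fun y => (1 - χ y) * K y) =ᶠ[𝓝 y] fun _ => 0 := by
    intro y hy
    have : Metric.ball (0 : Fin d → ℝ) c ∈ 𝓝 y :=
      Metric.isOpen_ball.mem_nhds (by simpa using hy)
    filter_upwards [this] with w hw
    rw [χ.one_of_mem_closedBall (Metric.ball_subset_closedBall hw)]
    simp
  refine ⟨contDiff_iff_contDiffAt.2 fun y => ?_, ?_, ?_⟩
  · by_cases hy : y = 0
    · exact contDiffAt_const.congr_of_eventuallyEq (hz y (by simpa [hy] using hc0))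
    · exact (contDiffAt_const.sub hχs.contDiffAt).mul (hKat y hy)
  · refine HasCompactSupport.of_support_subset_isCompact
      (isCompact_closedBall (0 : Fin d → ℝ) ((max R 1) ^ (∑ i, s i))) ?_
    intro y hy
    have hyR : sNorm s y ≤ R := by
      by_contra hcon
      exact hy (by simp [hR y (not_le.1 hcon)])
    rw [mem_closedBall_zero_iff]
    refine (pi_norm_le_iff_of_nonneg (by positivity)).2 fun i => ?_
    refine (abs_le_sNorm s hs y i).trans ?_
    refine (pow_le_pow_left₀ (sNorm_nonneg s y) (hyR.trans (le_max_left R 1)) _).trans ?_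
    exact pow_le_pow_right₀ (le_max_right R 1)
      (Finset.single_le_sum (f := s) (fun _ _ => Nat.zero_le _) (Finset.mem_univ i))
  · intro y hy
    have hy0 := sNorm_pos s hs hy
    rcases lt_or_ge ‖y‖ c with hyc | hyc
    · rw [(mderiv_congr ℓ (hz y hyc)).eq_of_nhds, mderiv_zero, abs_zero]
      positivity
    have hsc : c ≤ sNorm s y := by
      by_contra hcon
      have := norm_le_sNorm s hs (x := y) (by linarith)
      linarith
    have hM : ∀ a : List (Fin d), a.Sublist ℓ → |mderiv a K y| ≤ N * Q * sNorm s y ^ ζ := by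
      intro a ha
      have hle := sdeg_sublist s ha
      refine (hN a hle y hy).trans ?_
      rw [mul_assoc]
      refine mul_le_mul_of_nonneg_left ?_ hN0
      rw [sub_eq_add_neg, Real.rpow_add hy0, mul_comm]
      refine mul_le_mul_of_nonneg_right ?_ (by positivity)
      refine (Real.rpow_le_rpow_of_nonpos hc0 hsc (by simp)).trans ?_
      exact Real.rpow_le_rpow_of_exponent_ge hc0 hχ (by simpa using hle)
    have hχy : ContDiffAt ℝ (⊤ : ℕ∞) (χ : (Fin d → ℝ) → ℝ) y := hχs.contDiffAt
    have hL := leibniz ℓ χ K y P _ hχy (hKat y hy) (fun a ha => hPb a ha y) hM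
    have e : (fun y => (1 - χ y) * K y) = fun y => K y + (-1) * (χ y * K y) := by
      funext y; ring
    rw [e, (mderiv_add_ev ℓ (hKat y hy)
      (contDiffAt_const.mul (hχy.mul (hKat y hy)))).eq_of_nhds, mderiv_const_mul]
    refine (abs_add_le _ _).trans ?_
    beta_reduce
    rw [neg_one_mul, abs_neg]
    refine (add_le_add (hM ℓ (List.Sublist.refl _)) hL).trans (le_of_eq ?_)
    ring

theorem conv_bound (hd : 0 < d) {ζ₁ ζ₂ : ℝ} {f g : (Fin d → ℝ) → ℝ} {a b C : ℝ} {x : Fin d → ℝ}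
    (ha : 0 ≤ a) (hb : 0 ≤ b)
    (hf : ∀ t, t ≠ 0 → |f t| ≤ a * sNorm s t ^ ζ₂) (hg : ∀ t, t ≠ 0 → |g t| ≤ b * sNorm s t ^ ζ₁)
    (hI : Integrable (fun y => sNorm s (x - y) ^ ζ₁ * sNorm s y ^ ζ₂))
    (hC : ∫ y, sNorm s (x - y) ^ ζ₁ * sNorm s y ^ ζ₂ ≤ C) :
    |∫ t, f t * g (x - t)| ≤ a * b * C := by
  have : Nonempty (Fin d) := ⟨⟨0, hd⟩⟩
  have hae : ∀ᵐ t : Fin d → ℝ, t ≠ 0 := by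
    rw [ae_iff]; simp
  have hae2 : ∀ᵐ t : Fin d → ℝ, t ≠ x := by
    rw [ae_iff]; simp
  have := norm_integral_le_of_norm_le (f := fun t => f t * g (x - t)) (hI.const_mul (a * b)) (by
    filter_upwards [hae, hae2] with t h1 h2
    rw [norm_mul]
    refine (mul_le_mul (hf t h1) (hg (x - t) (sub_ne_zero.2 h2.symm)) (abs_nonneg _)
      (mul_nonneg ha (Real.rpow_nonneg (sNorm_nonneg s t) _))).trans (le_of_eq ?_)
    ring)
  refine this.trans ?_
  rw [integral_const_mul]
  exact mul_le_mul_of_nonneg_left hC (mul_nonneg ha hb)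

theorem unit_bound (hs : ∀ i, 0 < s i) (hd : 0 < d) {ζ₁ ζ₂ : ℝ}
    (h1 : -(∑ i, (s i : ℝ)) < ζ₁) (h1' : -(∑ i, (s i : ℝ)) < ζ₂)
    (h2 : ζ₁ + ζ₂ + (∑ i, (s i : ℝ)) < 0) (ℓ : List (Fin d)) :
    ∃ C : ℝ, 0 ≤ C ∧ ∀ K₁ K₂ N₁ N₂ R, 0 ≤ N₁ → 0 ≤ N₂ →
      Ker s ζ₁ (sdeg s ℓ) R K₁ N₁ → Ker s ζ₂ (sdeg s ℓ) R K₂ N₂ →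
      ∀ x, sNorm s x = 1 → |mderiv ℓ (fun z => ∫ y, K₁ (z - y) * K₂ y) x| ≤ C * N₁ * N₂ := by
  obtain ⟨δ, hδ, hδ1⟩ := Metric.continuousAt_iff.1
    ((sNorm_cont s hs).continuousAt (x := 0)) 1 one_pos
  set δ' := min δ 1
  have hδ' : 0 < δ' := lt_min hδ one_pos
  have hδ'1 : δ' ≤ 1 := min_le_right _ _
  have hbig : ∀ x, sNorm s x = 1 → δ' ≤ ‖x‖ := by
    intro x hx
    by_contra hcon
    have : ‖x‖ < δ := (not_le.1 hcon).trans_le (min_le_left _ _)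
    have := hδ1 (x := x) (by simpa using this)
    rw [sNorm_zero s hs, hx] at this
    simp at this
  let χ : ContDiffBump (0 : Fin d → ℝ) := ⟨δ' / 8, δ' / 4, by positivity, by linarith⟩
  have hrout : χ.rOut = δ' / 4 := rfl
  have hχin : χ.rIn ≤ 1 := by change δ' / 8 ≤ 1; linarith
  have hz1 : ζ₁ < 0 := by linarith
  have hz2 : ζ₂ < 0 := by linarith
  obtain ⟨D₁, hD₁, HB₁⟩ := Bprop s hs χ hχin ℓ ζ₁
  obtain ⟨D₂, hD₂, HB₂⟩ := Bprop s hs χ hχin ℓ ζ₂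
  obtain ⟨C₁, hC₁, HI₁⟩ := Ibound s hs hd h1 h1' h2
  obtain ⟨C₂, hC₂, HI₂⟩ := Ibound s hs hd h1' h1 (by linarith)
  refine ⟨D₁ * C₁ + D₂ * C₂, by positivity, ?_⟩
  intro K₁ K₂ N₁ N₂ R hN₁ hN₂ hK₁ hK₂ x hx
  obtain ⟨B1s, B1c, B1b⟩ := HB₁ K₁ N₁ R hN₁ hK₁
  obtain ⟨B2s, B2c, B2b⟩ := HB₂ K₂ N₂ R hN₂ hK₂
  have bd1 : ∀ t, t ≠ 0 → |K₁ t| ≤ N₁ * sNorm s t ^ ζ₁ := fun t ht => by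
    simpa [mderiv, sdeg] using hK₁.2.2 [] (by simp [sdeg]) t ht
  have bd2 : ∀ t, t ≠ 0 → |K₂ t| ≤ N₂ * sNorm s t ^ ζ₂ := fun t ht => by
    simpa [mderiv, sdeg] using hK₂.2.2 [] (by simp [sdeg]) t ht
  have bdA : ∀ t, t ≠ 0 → |χ t * K₂ t| ≤ N₂ * sNorm s t ^ ζ₂ := fun t ht => by
    rw [abs_mul, abs_of_nonneg χ.nonneg]
    exact (mul_le_of_le_one_left (abs_nonneg _) χ.le_one).trans (bd2 t ht)
  have iK1 : Integrable K₁ := kernel_integrable s hs hd h1 hz1.le hK₁.1.continuousOn hK₁.2.1 bd1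
  have iA2 : Integrable (fun t => χ t * K₂ t) :=
    kernel_integrable s hs hd h1' hz2.le (χ.continuous.continuousOn.mul hK₂.1.continuousOn)
      (fun t ht => by rw [hK₂.2.1 t ht, mul_zero]) bdA
  set B₁ : (Fin d → ℝ) → ℝ := fun y => (1 - χ y) * K₁ y with hB₁
  set B₂ : (Fin d → ℝ) → ℝ := fun y => (1 - χ y) * K₂ y with hB₂
  set A₂ : (Fin d → ℝ) → ℝ := fun y => χ y * K₂ y with hA₂
  have e : (fun z => ∫ y, K₁ (z - y) * K₂ y) =ᶠ[𝓝 x]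
      fun z => (∫ t, A₂ t * B₁ (z - t)) + ∫ t, K₁ t * B₂ (z - t) := by
    have hnb : {z : Fin d → ℝ | δ' / 2 < ‖z‖} ∈ 𝓝 x :=
      (isOpen_lt continuous_const continuous_norm).mem_nhds (by
        have := hbig x hx
        change δ' / 2 < ‖x‖
        linarith)
    filter_upwards [hnb] with z hz
    have hz : δ' / 2 < ‖z‖ := hz
    have I1 : Integrable (fun t => A₂ t * B₁ (z - t)) :=
      B1c.convolutionExists_right (ContinuousLinearMap.mul ℝ ℝ) iA2.locallyIntegrable
        B1s.continuous z
    have I2 : Integrable (fun t => K₁ t * B₂ (z - t)) :=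
      B2c.convolutionExists_right (ContinuousLinearMap.mul ℝ ℝ) iK1.locallyIntegrable
        B2s.continuous z
    have I2' := I2.comp_sub_left z
    rw [← integral_sub_left_eq_self (fun t => K₁ t * B₂ (z - t)) volume z, ← integral_add I1 I2']
    refine integral_congr_ae (ae_of_all _ fun y => ?_)
    have hmid : χ (z - y) * χ y = 0 := by
      by_cases hy : ‖y‖ < δ' / 4
      · have h3 : δ' / 4 ≤ ‖z - y‖ := by
          have := norm_sub_norm_le z y
          linarith
        rw [χ.zero_of_le_dist (by rw [hrout]; simpa using h3), zero_mul]
      · rw [χ.zero_of_le_dist (x := y) (by rw [hrout]; simpa using hy), mul_zero]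
    simp only [hA₂, hB₁, hB₂, sub_sub_cancel]
    linear_combination (K₁ (z - y) * K₂ y) * hmid
  rw [(mderiv_congr ℓ e).eq_of_nhds]
  have S1 : ContDiff ℝ (⊤ : ℕ∞) (fun z => ∫ t, A₂ t * B₁ (z - t)) :=
    B1c.contDiff_convolution_right (ContinuousLinearMap.mul ℝ ℝ) iA2.locallyIntegrable B1s
  have S2 : ContDiff ℝ (⊤ : ℕ∞) (fun z => ∫ t, K₁ t * B₂ (z - t)) :=
    B2c.contDiff_convolution_right (ContinuousLinearMap.mul ℝ ℝ) iK1.locallyIntegrable B2s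
  rw [(mderiv_add_ev ℓ S1.contDiffAt S2.contDiffAt).eq_of_nhds,
    mderiv_conv ℓ iA2.locallyIntegrable B1s B1c, mderiv_conv ℓ iK1.locallyIntegrable B2s B2c]
  have b1 := conv_bound s hd hN₂ (mul_nonneg hD₁ hN₁) bdA B1b (HI₁ x hx).1 (HI₁ x hx).2
  have b2 := conv_bound s hd hN₁ (mul_nonneg hD₂ hN₂) bd1 B2b (HI₂ x hx).1 (HI₂ x hx).2
  refine (abs_add_le _ _).trans ((add_le_add b1 b2).trans (le_of_eq ?_))
  ring

end main

section scaling
variable {d : ℕ} (s : Fin d → ℕ)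

/-- The anisotropic dilation by `r`. -/
noncomputable def dil (r : ℝ) (hr : 0 < r) : (Fin d → ℝ) ≃L[ℝ] (Fin d → ℝ) :=
  ContinuousLinearEquiv.piCongrRight fun i =>
    ContinuousLinearEquiv.unitsEquivAut ℝ (Units.mk0 (r ^ (s i)) (pow_pos hr _).ne')

theorem dil_apply (r : ℝ) (hr : 0 < r) (x : Fin d → ℝ) (i : Fin d) :
    dil s r hr x i = r ^ (s i) * x i := by
  simp [dil, mul_comm]

theorem sNorm_dil (hs : ∀ i, 0 < s i) (r : ℝ) (hr : 0 < r) (x : Fin d → ℝ) :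
    sNorm s (dil s r hr x) = r * sNorm s x := by
  unfold sNorm
  rw [Finset.mul_sum]
  refine Finset.sum_congr rfl fun i _ => ?_
  rw [dil_apply, abs_mul, Real.mul_rpow (abs_nonneg _) (abs_nonneg _),
    abs_of_pos (pow_pos hr _), Real.pow_rpow_inv_natCast hr.le (hs i).ne']

theorem dil_single (r : ℝ) (hr : 0 < r) (i : Fin d) :
    dil s r hr (Pi.single i 1) = (r ^ (s i)) • Pi.single i 1 := by
  funext j
  rw [dil_apply]
  by_cases h : j = i
  · subst h; simp
  · simp [h]

theorem prod_sdeg (r : ℝ) (ℓ : List (Fin d)) :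
    (ℓ.map (fun i => r ^ (s i))).prod = r ^ (sdeg s ℓ) := by
  induction ℓ with
  | nil => simp [sdeg]
  | cons i ℓ ih => simp [sdeg, pow_add] at ih ⊢; exact Or.inl ih

theorem mderiv_dil (r : ℝ) (hr : 0 < r) (ℓ : List (Fin d)) (f : (Fin d → ℝ) → ℝ) (x : Fin d → ℝ) :
    mderiv ℓ (fun y => f (dil s r hr y)) x = r ^ (sdeg s ℓ) * mderiv ℓ f (dil s r hr x) := by
  rw [mderiv_comp ℓ f (dil s r hr) (fun i => r ^ (s i)) (dil_single s r hr), prod_sdeg]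

theorem integral_dil (r : ℝ) (hr : 0 < r) (g : (Fin d → ℝ) → ℝ) :
    ∫ y, g y = r ^ (∑ i, s i) * ∫ y, g (dil s r hr y) := by
  have hdet : (Matrix.diagonal (fun i => r ^ (s i))).det = r ^ (∑ i, s i) := by
    rw [Matrix.det_diagonal, Finset.prod_pow_eq_pow_sum]
  have hpos : 0 < r ^ (∑ i, s i) := pow_pos hr _
  have key := Real.smul_map_diagonal_volume_pi (D := fun i => r ^ (s i)) (by
    rw [hdet]; exact hpos.ne')
  have hfun : (Matrix.toLin' (Matrix.diagonal fun i => r ^ (s i)) : (Fin d → ℝ) → (Fin d → ℝ))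
      = (dil s r hr).toHomeomorph.toMeasurableEquiv := by
    funext x
    funext i
    change _ = dil s r hr x i
    rw [dil_apply, Matrix.toLin'_apply, Matrix.mulVec_diagonal]
  rw [hdet, abs_of_pos hpos, hfun] at key
  conv_lhs => rw [← key]
  rw [integral_smul_measure, integral_map_equiv, ENNReal.toReal_ofReal hpos.le]
  rfl

theorem ker_dil (hs : ∀ i, 0 < s i) {ζ : ℝ} {n : ℕ} {R : ℝ} {K : (Fin d → ℝ) → ℝ} {N : ℝ}
    (h : Ker s ζ n R K N) (r : ℝ) (hr : 0 < r) :
    Ker s ζ n (R / r) (fun y => K (dil s r hr y)) (N * r ^ ζ) := by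
  obtain ⟨h1, h2, h3⟩ := h
  have hne : ∀ x, x ≠ 0 → dil s r hr x ≠ 0 := fun x hx =>
    (map_ne_zero_iff _ (dil s r hr).injective).2 hx
  refine ⟨h1.comp (dil s r hr).contDiff.contDiffOn hne, fun x hx => h2 _ ?_, fun ℓ hℓ x hx => ?_⟩
  · rw [sNorm_dil s hs]
    rwa [div_lt_iff₀' hr] at hx
  · have := h3 ℓ hℓ _ (hne x hx)
    rw [mderiv_dil, abs_mul, abs_of_pos (pow_pos hr _)]
    refine (mul_le_mul_of_nonneg_left this (pow_pos hr _).le).trans (le_of_eq ?_)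
    rw [sNorm_dil s hs, Real.mul_rpow hr.le (sNorm_nonneg s x), Real.rpow_sub hr,
      Real.rpow_natCast]
    have := (pow_pos hr (sdeg s ℓ)).ne'
    field_simp

theorem length_le_sdeg (hs : ∀ i, 0 < s i) (ℓ : List (Fin d)) : ℓ.length ≤ sdeg s ℓ := by
  induction ℓ with
  | nil => simp
  | cons i ℓ ih =>
    have := hs i
    simp [sdeg] at ih ⊢
    omega

end scaling

/-- Second part of Lemma 10.14: if `K₁, K₂` are compactly supported kernels, smooth away from
the origin, of orders `ζ₁, ζ₂` with `ζ₁ ∧ ζ₂ > -|s|` and `ζ̄ = ζ₁ + ζ₂ + |s| < 0`, then the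
convolution `K₁ * K₂` is of order `ζ̄`, with
`⦀K₁ * K₂⦀_{ζ̄;m} ≤ C ⦀K₁⦀_{ζ₁;m} ⦀K₂⦀_{ζ₂;m}` for a constant `C` depending only on the
supports (here: on the support radius `R`). -/
theorem stmt_7 {d : ℕ} (s : Fin d → ℕ) (hs : ∀ i, 0 < s i) (ζ₁ ζ₂ : ℝ) (m : ℕ) (R : ℝ)
    (h1 : -(∑ i, (s i : ℝ)) < min ζ₁ ζ₂)
    (h2 : ζ₁ + ζ₂ + (∑ i, (s i : ℝ)) < 0) :
    ∃ C : ℝ, ∀ (K₁ K₂ : (Fin d → ℝ) → ℝ) (N₁ N₂ : ℝ),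
      ContDiffOn ℝ (⊤ : ℕ∞) K₁ {x | x ≠ 0} → ContDiffOn ℝ (⊤ : ℕ∞) K₂ {x | x ≠ 0} →
      (∀ x : Fin d → ℝ, R < sNorm s x → K₁ x = 0) →
      (∀ x : Fin d → ℝ, R < sNorm s x → K₂ x = 0) →
      (∀ ℓ : List (Fin d), sdeg s ℓ ≤ m → ∀ x : Fin d → ℝ, x ≠ 0 →
        |mderiv ℓ K₁ x| ≤ N₁ * sNorm s x ^ (ζ₁ - (sdeg s ℓ : ℝ))) →
      (∀ ℓ : List (Fin d), sdeg s ℓ ≤ m → ∀ x : Fin d → ℝ, x ≠ 0 →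
        |mderiv ℓ K₂ x| ≤ N₂ * sNorm s x ^ (ζ₂ - (sdeg s ℓ : ℝ))) →
      ∀ ℓ : List (Fin d), sdeg s ℓ ≤ m → ∀ x : Fin d → ℝ, x ≠ 0 →
        |mderiv ℓ (fun z => ∫ y, K₁ (z - y) * K₂ y) x|
          ≤ C * N₁ * N₂ * sNorm s x ^ (ζ₁ + ζ₂ + (∑ i, (s i : ℝ)) - (sdeg s ℓ : ℝ)) := by
  classical
  rcases Nat.eq_zero_or_pos d with hd | hd
  · subst hd
    exact ⟨0, fun K₁ K₂ N₁ N₂ _ _ _ _ _ _ ℓ _ x hx => absurd (Subsingleton.elim x 0) hx⟩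
  have hu := unit_bound s hs hd (lt_of_lt_of_le h1 (min_le_left _ _))
    (lt_of_lt_of_le h1 (min_le_right _ _)) h2
  choose Cf hC0 hCf using hu
  have hfin := List.finite_length_le (Fin d) m
  refine ⟨∑ ℓ ∈ hfin.toFinset, Cf ℓ, ?_⟩
  intro K₁ K₂ N₁ N₂ s1 s2 r1 r2 b1 b2 ℓ hℓ x hx
  set r := sNorm s x with hrdef
  have hr : 0 < r := sNorm_pos s hs hx
  have hN₁ : 0 ≤ N₁ := by
    have := (abs_nonneg _).trans (b1 [] (by simp [sdeg]) x hx)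
    exact nonneg_of_mul_nonneg_left this (Real.rpow_pos_of_pos hr _)
  have hN₂ : 0 ≤ N₂ := by
    have := (abs_nonneg _).trans (b2 [] (by simp [sdeg]) x hx)
    exact nonneg_of_mul_nonneg_left this (Real.rpow_pos_of_pos hr _)
  have k1 : Ker s ζ₁ (sdeg s ℓ) R K₁ N₁ := ⟨s1, r1, fun a ha => b1 a (ha.trans hℓ)⟩
  have k2 : Ker s ζ₂ (sdeg s ℓ) R K₂ N₂ := ⟨s2, r2, fun a ha => b2 a (ha.trans hℓ)⟩
  set u := (dil s r hr).symm x with hu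
  have hux : dil s r hr u = x := by simp [hu]
  have hun : sNorm s u = 1 := by
    have := sNorm_dil s hs r hr u
    rw [hux, ← hrdef] at this
    have h3 : r * sNorm s u = r * 1 := by rw [mul_one]; exact this.symm
    exact mul_left_cancel₀ hr.ne' h3
  have main := hCf ℓ _ _ _ _ (R / r) (mul_nonneg hN₁ (Real.rpow_nonneg hr.le ζ₁))
    (mul_nonneg hN₂ (Real.rpow_nonneg hr.le ζ₂)) (ker_dil s hs k1 r hr) (ker_dil s hs k2 r hr) u hun
  set F : (Fin d → ℝ) → ℝ := fun z => ∫ y, K₁ (z - y) * K₂ y with hF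
  have hpow : 0 < r ^ (∑ i, s i) := pow_pos hr _
  have econv : (fun z => ∫ y, K₁ (dil s r hr (z - y)) * K₂ (dil s r hr y))
      = fun z => (r ^ (∑ i, s i))⁻¹ * F (dil s r hr z) := by
    funext z
    have := integral_dil s r hr (fun y => K₁ (dil s r hr z - y) * K₂ y)
    simp only [hF]
    rw [this, inv_mul_cancel_left₀ hpow.ne']
    simp only [map_sub]
  rw [econv, mderiv_const_mul] at main
  beta_reduce at main
  rw [mderiv_dil, hux, abs_mul, abs_mul, abs_of_pos (inv_pos.2 hpow),
    abs_of_pos (pow_pos hr _)] at main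
  have hCle : Cf ℓ ≤ ∑ ℓ ∈ hfin.toFinset, Cf ℓ :=
    Finset.single_le_sum (f := Cf) (fun a _ => hC0 a)
      (by simpa using (length_le_sdeg s hs ℓ).trans hℓ)
  have e1 : r ^ (ζ₁ + ζ₂ + (∑ i, (s i : ℝ)) - (sdeg s ℓ : ℝ))
      = r ^ ζ₁ * r ^ ζ₂ * r ^ (∑ i, s i) / r ^ (sdeg s ℓ) := by
    rw [Real.rpow_sub hr, Real.rpow_add hr, Real.rpow_add hr, Real.rpow_natCast,
      ← Nat.cast_sum, Real.rpow_natCast]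
  have hdeg : 0 < r ^ (sdeg s ℓ) := pow_pos hr _
  have e2 : |mderiv ℓ F x| ≤ Cf ℓ * N₁ * N₂ *
      (r ^ ζ₁ * r ^ ζ₂ * r ^ (∑ i, s i) / r ^ (sdeg s ℓ)) := by
    rw [inv_mul_le_iff₀ hpow] at main
    rw [← mul_div_assoc, le_div_iff₀ hdeg]
    linarith
  rw [e1]
  refine e2.trans ?_
  have : 0 ≤ r ^ ζ₁ * r ^ ζ₂ * r ^ (∑ i, s i) / r ^ (sdeg s ℓ) := by positivity
  gcongr
end

section
/- Failure of multiplication below the critical threshold, one-dimensional wavelet-free version: let α, β < 0 with α + β ≤ 0. Then there exist sequences (f_n) and (g_n) of smooth functions, compactly supported in a fixed compact set K ⊂ ℝ^d, such that (f_n) is bounded in the Besov–Hölder space C^α_s, (g_n) is bounded in C^β_s, but the L²-pairing ⟨f_n, g_n⟩ = ∫ f_n(x) g_n(x) dx tends to +∞. Consequently, the product does not extend to a continuous bilinear map C^α_s × C^β_s → D'(ℝ^d) when α + β ≤ 0. -/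
open MeasureTheory

/-- The pairing of a function `f` with the rescaled–recentred test function
`S^δ_{s,x} η (y) = δ^{-|s|} η(S_s^δ (y - x))`. -/
noncomputable def sPair {d : ℕ} (s : Fin d → ℕ) (f : (Fin d → ℝ) → ℝ) (x : Fin d → ℝ)
    (δ : ℝ) (η : (Fin d → ℝ) → ℝ) : ℝ :=
  ∫ y, f y * ((δ ^ (∑ i, s i) : ℝ)⁻¹ * η fun i => (y i - x i) / δ ^ (s i))

/-- Admissible test functions of class `C^r`: supported in the scaled unit ball, with all
derivatives up to order `r` bounded by `1`. -/
def Adm {d : ℕ} (s : Fin d → ℕ) (r : ℕ) (η : (Fin d → ℝ) → ℝ) : Prop :=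
  ContDiff ℝ (r : ℕ∞) η ∧ (∀ y, 1 < sNorm s y → η y = 0) ∧
    ∀ i ≤ r, ∀ y, ‖iteratedFDeriv ℝ i η y‖ ≤ 1

theorem aux_osc {d : ℕ} (i0 : Fin d) (S : Set (Fin d → ℝ)) (hS : IsCompact S) (B μ : ℝ)
    (hμ : 0 < μ) (k : ℕ) : ∀ (G : (Fin d → ℝ) → ℝ), ContDiff ℝ k G → tsupport G ⊆ S →
    (∀ z, ‖iteratedFDeriv ℝ k G z‖ ≤ B) → ∀ φ : ℝ,
    |∫ z, G z * Real.cos (μ * z i0 + φ)| ≤ B * volume.real S / μ ^ k := by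
  induction k with
  | zero =>
    intro G hG hsup hB φ
    have h0 : ∀ z, z ∉ S → G z * Real.cos (μ * z i0 + φ) = 0 := by
      intro z hz
      rw [image_eq_zero_of_notMem_tsupport (fun h => hz (hsup h)), zero_mul]
    rw [← setIntegral_eq_integral_of_forall_compl_eq_zero h0, pow_zero, div_one]
    rw [← Real.norm_eq_abs]
    refine norm_setIntegral_le_of_norm_le_const (hS.measure_lt_top (μ := volume)) ?_
    intro z _
    have h1 := hB z
    rw [norm_iteratedFDeriv_zero] at h1
    rw [norm_mul]
    calc ‖G z‖ * ‖Real.cos (μ * z i0 + φ)‖ ≤ ‖G z‖ * 1 := by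
          gcongr
          exact Real.abs_cos_le_one _
      _ ≤ B := by simpa using h1
  | succ k ih =>
    intro G hG hsup hB φ
    set e : Fin d → ℝ := Pi.single i0 1 with he
    have hcs : HasCompactSupport G := hS.of_isClosed_subset (isClosed_tsupport _) hsup
    have hGd : Differentiable ℝ G := hG.differentiable (by simp)
    have hGc := hGd.continuous
    have hfd : ContDiff ℝ k (fderiv ℝ G) := hG.fderiv_right (by norm_cast)
    have hfde : ContDiff ℝ k (fun z => fderiv ℝ G z e) := hfd.clm_apply contDiff_const
    have hD : ∀ z : Fin d → ℝ, HasFDerivAt (fun z : Fin d → ℝ => Real.sin (μ * z i0 + φ))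
        (Real.cos (μ * z i0 + φ) • (μ • (ContinuousLinearMap.proj (R := ℝ) i0 :
          (Fin d → ℝ) →L[ℝ] ℝ))) z := by
      intro z
      have h1 : HasFDerivAt (fun z : Fin d → ℝ => μ * z i0 + φ)
        (μ • (ContinuousLinearMap.proj (R := ℝ) i0 : (Fin d → ℝ) →L[ℝ] ℝ)) z :=
        ((ContinuousLinearMap.proj (R := ℝ) (φ := fun _ : Fin d => ℝ) i0).hasFDerivAt.const_mul
          μ).add_const φ
      exact h1.sin
    have hDe : ∀ z : Fin d → ℝ, fderiv ℝ (fun z : Fin d → ℝ => Real.sin (μ * z i0 + φ)) z e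
        = μ * Real.cos (μ * z i0 + φ) := by
      intro z
      rw [(hD z).fderiv]
      simp [he, mul_comm]
    have hcsin : Continuous fun z : Fin d → ℝ => Real.sin (μ * z i0 + φ) := by fun_prop
    have hccos : Continuous fun z : Fin d → ℝ => μ * Real.cos (μ * z i0 + φ) := by fun_prop
    have key := integral_mul_fderiv_eq_neg_fderiv_mul_of_integrable (μ := (volume : Measure (Fin d → ℝ)))
      (f := G) (g := fun z : Fin d → ℝ => Real.sin (μ * z i0 + φ)) (v := e)
      ((hfde.continuous.mul hcsin).integrable_of_hasCompactSupport
        ((hcs.fderiv_apply (𝕜 := ℝ) e).mul_right))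
      (by
        simp only [hDe]
        exact (hGc.mul hccos).integrable_of_hasCompactSupport hcs.mul_right)
      ((hGc.mul hcsin).integrable_of_hasCompactSupport hcs.mul_right)
      (fun z _ => hGd z) (fun z _ => (hD z).differentiableAt)
    simp only [hDe] at key
    have h2 := ih (fun z => fderiv ℝ G z e) hfde
      ((tsupport_fderiv_apply_subset ℝ e).trans hsup) (by
        intro z
        have h3 := (ContinuousLinearMap.apply ℝ ℝ e).norm_iteratedFDeriv_comp_left
          (hfd.contDiffAt (x := z)) (n := k) le_rfl
        rw [norm_iteratedFDeriv_fderiv] at h3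
        have h4 : ‖(ContinuousLinearMap.apply ℝ ℝ e : ((Fin d → ℝ) →L[ℝ] ℝ) →L[ℝ] ℝ)‖ ≤ 1 := by
          refine ContinuousLinearMap.opNorm_le_bound _ zero_le_one ?_
          intro L
          have := L.le_opNorm e
          have hee : ‖e‖ = 1 := by rw [he, Pi.norm_single, norm_one]
          rw [hee] at this
          simpa using this
        calc _ ≤ _ := h3
          _ ≤ 1 * B := by
            gcongr
            exact hB z
          _ = B := one_mul _) (φ - Real.pi / 2)
    have h5 : ∀ z : Fin d → ℝ, Real.cos (μ * z i0 + (φ - Real.pi / 2)) = Real.sin (μ * z i0 + φ) := by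
      intro z
      rw [← add_sub_assoc, Real.cos_sub_pi_div_two]
    simp only [h5] at h2
    have h6 : μ * ∫ z, G z * Real.cos (μ * z i0 + φ)
        = - ∫ z, fderiv ℝ G z e * Real.sin (μ * z i0 + φ) := by
      rw [← key, ← integral_const_mul]
      congr 1
      ext z
      ring
    have h7 : μ * |∫ z, G z * Real.cos (μ * z i0 + φ)| ≤ B * volume.real S / μ ^ k := by
      rw [← abs_of_pos hμ, ← abs_mul, abs_of_pos hμ, h6, abs_neg]
      exact h2
    rw [pow_succ, ← div_div, le_div_iff₀ hμ, mul_comm]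
    exact h7

theorem aux_cov {d : ℕ} (s : Fin d → ℕ) (f : (Fin d → ℝ) → ℝ) (x : Fin d → ℝ)
    (δ : ℝ) (hδ : 0 < δ) (η : (Fin d → ℝ) → ℝ) (hf : Continuous f) (hη : Continuous η) :
    sPair s f x δ η = ∫ z, f (fun i => x i + δ ^ (s i) * z i) * η z := by
  unfold sPair
  set D : Fin d → ℝ := fun i => δ ^ (s i) with hD
  have hdet : (Matrix.diagonal D).det = δ ^ (∑ i, s i) := by
    rw [Matrix.det_diagonal, Finset.prod_pow_eq_pow_sum]
  have hpos : (0:ℝ) < δ ^ (∑ i, s i) := pow_pos hδ _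
  set H : (Fin d → ℝ) → ℝ := fun y => f y * ((δ ^ (∑ i, s i) : ℝ)⁻¹ * η fun i => (y i - x i) / δ ^ (s i)) with hH
  have hHc : Continuous H := by
    refine hf.mul (continuous_const.mul (hη.comp ?_))
    fun_prop
  have h1 : ∫ y, H y = ∫ y, H (y + x) := (integral_add_right_eq_self H x).symm
  rw [h1]
  have hL : Measurable (Matrix.toLin' (Matrix.diagonal D)) :=
    (LinearMap.continuous_on_pi _).measurable
  have h2 := Real.smul_map_diagonal_volume_pi (D := D) (by rw [hdet]; exact hpos.ne')
  have hHx : Continuous fun y => H (y + x) := by fun_prop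
  conv_lhs => rw [← h2]
  rw [integral_smul_measure, integral_map hL.aemeasurable hHx.aestronglyMeasurable, hdet,
    abs_of_pos hpos, ENNReal.toReal_ofReal hpos.le, smul_eq_mul, ← integral_const_mul]
  congr 1
  ext z
  have h3 : (Matrix.toLin' (Matrix.diagonal D)) z + x = fun i => x i + δ ^ (s i) * z i := by
    ext i
    simp [Matrix.mulVec_diagonal, hD, add_comm]
  have h4 : (fun i => (x i + δ ^ (s i) * z i - x i) / δ ^ (s i)) = z := by
    ext i
    have : δ ^ (s i) ≠ 0 := (pow_pos hδ _).ne'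
    field_simp
    ring
  rw [h3]
  simp only [hH]
  rw [h4]
  field_simp

theorem aux_comp {d : ℕ} (χ : (Fin d → ℝ) → ℝ) (hχ : ContDiff ℝ (⊤ : ℕ∞) χ) (x D : Fin d → ℝ)
    (hD : ∀ i, |D i| ≤ 1) (A : ℝ) (j : ℕ) (hA : ∀ y, ‖iteratedFDeriv ℝ j χ y‖ ≤ A)
    (z : Fin d → ℝ) :
    ‖iteratedFDeriv ℝ j (fun z => χ (fun i => x i + D i * z i)) z‖ ≤ A := by
  set L : (Fin d → ℝ) →L[ℝ] (Fin d → ℝ) :=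
    ContinuousLinearMap.pi fun i => D i • ContinuousLinearMap.proj i with hL
  have hLn : ‖L‖ ≤ 1 := by
    refine ContinuousLinearMap.opNorm_le_bound _ zero_le_one ?_
    intro z
    rw [one_mul]
    refine (pi_norm_le_iff_of_nonneg (norm_nonneg _)).2 ?_
    intro i
    simp only [hL, ContinuousLinearMap.coe_pi', smul_apply,
      ContinuousLinearMap.proj_apply, smul_eq_mul, norm_mul]
    calc ‖D i‖ * ‖z i‖ ≤ 1 * ‖z‖ := by
          gcongr
          · exact hD i
          · exact norm_le_pi_norm z i
      _ = _ := one_mul _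
  have h1 : (fun z => χ (fun i => x i + D i * z i)) = (fun y => χ (x + y)) ∘ L := by
    ext z
    simp only [Function.comp]
    congr 1
  have h2 : ContDiff ℝ (⊤ : ℕ∞) (fun y => χ (x + y)) := by fun_prop
  rw [h1, L.iteratedFDeriv_comp_right h2 z (i := j) (by exact_mod_cast le_top)]
  refine (ContinuousMultilinearMap.norm_compContinuousLinearMap_le _ _).trans ?_
  rw [iteratedFDeriv_comp_add_left]
  calc _ ≤ A * 1 := by
        gcongr
        · exact (norm_nonneg _).trans (hA 0)
        · exact hA _
        · exact Finset.prod_le_one (fun _ _ => norm_nonneg _) (fun _ _ => hLn)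
    _ = A := mul_one _

theorem aux_bdd {d : ℕ} (χ : (Fin d → ℝ) → ℝ) (hχ : ContDiff ℝ (⊤ : ℕ∞) χ)
    (hc : HasCompactSupport χ) (r : ℕ) :
    ∃ A : ℝ, 0 ≤ A ∧ ∀ j ≤ r, ∀ y, ‖iteratedFDeriv ℝ j χ y‖ ≤ A := by
  have h : ∀ j : ℕ, ∃ A : ℝ, ∀ y, ‖iteratedFDeriv ℝ j χ y‖ ≤ A := fun j =>
    (hc.iteratedFDeriv (𝕜 := ℝ) j).exists_bound_of_continuous
      (hχ.continuous_iteratedFDeriv (by exact_mod_cast le_top))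
  choose A hA using h
  refine ⟨∑ j ∈ Finset.range (r + 1), A j, Finset.sum_nonneg fun j _ =>
    (norm_nonneg _).trans (hA j 0), ?_⟩
  intro j hj y
  refine (hA j y).trans (Finset.single_le_sum (f := A) (fun j _ => (norm_nonneg _).trans (hA j 0))
    (Finset.mem_range.2 (by omega)))

theorem aux_supp {d : ℕ} (s : Fin d → ℕ) (hs : ∀ i, 0 < s i) (η : (Fin d → ℝ) → ℝ)
    (h : ∀ y, 1 < sNorm s y → η y = 0) (z : Fin d → ℝ) (hz : z ∉ Metric.closedBall 0 1) :
    η z = 0 := by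
  apply h
  simp only [Metric.mem_closedBall, dist_zero_right, not_le] at hz
  have : ∃ i, 1 < |z i| := by
    by_contra! hcon
    exact absurd ((pi_norm_le_iff_of_nonneg zero_le_one).2 hcon) (not_le.2 hz)
  obtain ⟨i, hi⟩ := this
  unfold sNorm
  refine lt_of_lt_of_le (Real.one_lt_rpow hi (z := ((s i : ℝ)⁻¹)) ?_)
    (Finset.single_le_sum (f := fun i => |z i| ^ ((s i : ℝ)⁻¹)) (fun j _ => by positivity)
      (Finset.mem_univ i))
  have := hs i
  positivity

theorem aux_main {d : ℕ} (i0 : Fin d) (s : Fin d → ℕ) (hs : ∀ i, 0 < s i)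
    (α : ℝ) (hα : α < 0) (r : ℕ) (hr : |α| < r) (χ : (Fin d → ℝ) → ℝ)
    (hχ : ContDiff ℝ (⊤ : ℕ∞) χ) (hc : HasCompactSupport χ) :
    ∃ C : ℝ, ∀ (M : ℝ), 1 ≤ M → ∀ (x : Fin d → ℝ) (δ : ℝ), 0 < δ → δ ≤ 1 →
      ∀ η : (Fin d → ℝ) → ℝ, Adm s r η →
        |sPair s (fun y => M ^ (-α) * (χ y * Real.cos (M ^ (s i0) * y i0))) x δ η| ≤ C * δ ^ α := by
  obtain ⟨A, hA0, hA⟩ := aux_bdd χ hχ hc r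
  set V : ℝ := volume.real (Metric.closedBall (0 : Fin d → ℝ) 1) with hV
  have hV0 : 0 ≤ V := measureReal_nonneg
  refine ⟨2 ^ r * A * V, ?_⟩
  intro M hM x δ hδ hδ1 η hη
  obtain ⟨hη1, hη2, hη3⟩ := hη
  have hM0 : 0 < M := by linarith
  have hη1' : ContDiff ℝ r η := by exact_mod_cast hη1
  set G : (Fin d → ℝ) → ℝ := fun z => χ (fun i => x i + δ ^ (s i) * z i) * η z with hG
  have hχ1 : ContDiff ℝ (⊤ : ℕ∞) (fun z : Fin d → ℝ => χ (fun i => x i + δ ^ (s i) * z i)) := by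
    refine hχ.comp ?_
    fun_prop
  have hχr : ContDiff ℝ r (fun z : Fin d → ℝ => χ (fun i => x i + δ ^ (s i) * z i)) :=
    hχ1.of_le (by exact_mod_cast le_top)
  have hGr : ContDiff ℝ r G := hχr.mul hη1'
  have hGs : tsupport G ⊆ Metric.closedBall 0 1 := by
    refine closure_minimal ?_ Metric.isClosed_closedBall
    intro z hz
    by_contra hcon
    exact hz (by simp only [hG]; rw [aux_supp s hs η hη2 z hcon, mul_zero])
  have hGb : ∀ k ≤ r, ∀ z, ‖iteratedFDeriv ℝ k G z‖ ≤ 2 ^ r * A := by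
    intro k hk z
    refine (norm_iteratedFDeriv_mul_le hχr hη1' z (n := k) (by exact_mod_cast hk)).trans ?_
    calc _ ≤ ∑ i ∈ Finset.range (k + 1), (k.choose i : ℝ) * A * 1 := by
          refine Finset.sum_le_sum fun i hi => ?_
          have hi' : i ≤ k := by simpa [Nat.lt_succ_iff] using hi
          gcongr
          · refine aux_comp χ hχ x (fun i => δ ^ (s i)) ?_ A i (hA i (by omega)) z
            intro i
            rw [abs_of_nonneg (by positivity)]
            exact pow_le_one₀ hδ.le hδ1
          · exact hη3 _ (by omega) z
      _ = 2 ^ k * A := by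
          simp only [mul_one]
          rw [← Finset.sum_mul]
          congr 1
          exact_mod_cast Nat.sum_range_choose k
      _ ≤ 2 ^ r * A := by
          gcongr
          norm_num
  have hμ : 0 < (M * δ) ^ (s i0) := by positivity
  have hosc : ∀ k ≤ r, |∫ z, G z * Real.cos ((M * δ) ^ (s i0) * z i0 + M ^ (s i0) * x i0)|
      ≤ 2 ^ r * A * V / ((M * δ) ^ (s i0)) ^ k := fun k hk =>
    aux_osc i0 _ (isCompact_closedBall 0 1) _ _ hμ k G (hGr.of_le (by exact_mod_cast hk)) hGs
      (hGb k hk) _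
  have hfc : Continuous (fun y : Fin d → ℝ => M ^ (-α) * (χ y * Real.cos (M ^ (s i0) * y i0))) := by
    have := hχ.continuous
    fun_prop
  rw [aux_cov s _ x δ hδ η hfc hη1.continuous]
  have heq : (∫ z, M ^ (-α) * (χ (fun i => x i + δ ^ (s i) * z i) *
      Real.cos (M ^ (s i0) * (x i0 + δ ^ (s i0) * z i0))) * η z) = M ^ (-α) *
      ∫ z, G z * Real.cos ((M * δ) ^ (s i0) * z i0 + M ^ (s i0) * x i0) := by
    rw [← integral_const_mul]
    congr 1
    ext z
    have : M ^ (s i0) * (x i0 + δ ^ (s i0) * z i0)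
      = (M * δ) ^ (s i0) * z i0 + M ^ (s i0) * x i0 := by rw [mul_pow]; ring
    rw [this]
    simp only [hG]
    ring
  rw [heq, abs_mul, abs_of_nonneg (by positivity : 0 ≤ M ^ (-α))]
  have hfin : |∫ z, G z * Real.cos ((M * δ) ^ (s i0) * z i0 + M ^ (s i0) * x i0)|
      ≤ 2 ^ r * A * V * (M * δ) ^ α := by
    rcases le_total (M * δ) 1 with h | h
    · refine (hosc 0 (Nat.zero_le _)).trans ?_
      rw [pow_zero, div_one]
      exact le_mul_of_one_le_right (by positivity)
        (Real.one_le_rpow_of_pos_of_le_one_of_nonpos (by positivity) h hα.le)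
    · refine (hosc r le_rfl).trans ?_
      rw [div_eq_mul_inv]
      gcongr
      rw [← pow_mul, ← Real.rpow_natCast, ← Real.rpow_neg (by positivity)]
      apply Real.rpow_le_rpow_of_exponent_le h
      rw [abs_of_neg hα] at hr
      have h1 : (1:ℝ) ≤ s i0 := by exact_mod_cast hs i0
      push_cast
      nlinarith
  calc _ ≤ M ^ (-α) * (2 ^ r * A * V * (M * δ) ^ α) := by gcongr
    _ = 2 ^ r * A * V * δ ^ α := by
      rw [Real.mul_rpow hM0.le hδ.le, Real.rpow_neg hM0.le]
      have : M ^ α ≠ 0 := (Real.rpow_pos_of_pos hM0 _).ne'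
      field_simp

/-- Failure of multiplication below the critical threshold (Proposition 4.14, necessity):
for `α, β < 0` with `α + β ≤ 0`, there are sequences of smooth functions supported in a fixed
compact set, bounded in `C^α_s` resp. `C^β_s`, whose `L²` pairings diverge. -/
theorem stmt_16 {d : ℕ} (hd : 0 < d) (s : Fin d → ℕ) (hs : ∀ i, 0 < s i)
    (α β : ℝ) (hα : α < 0) (hβ : β < 0) (hαβ : α + β ≤ 0)
    (r r' : ℕ) (hr : |α| < r) (hr' : |β| < r') :
    ∃ K : Set (Fin d → ℝ), IsCompact K ∧
      ∃ f g : ℕ → (Fin d → ℝ) → ℝ,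
        (∀ n, ContDiff ℝ (⊤ : ℕ∞) (f n) ∧ tsupport (f n) ⊆ K) ∧
        (∀ n, ContDiff ℝ (⊤ : ℕ∞) (g n) ∧ tsupport (g n) ⊆ K) ∧
        (∃ C : ℝ, ∀ (n : ℕ) (x : Fin d → ℝ) (δ : ℝ), 0 < δ → δ ≤ 1 →
          ∀ η : (Fin d → ℝ) → ℝ, Adm s r η → |sPair s (f n) x δ η| ≤ C * δ ^ α) ∧
        (∃ C : ℝ, ∀ (n : ℕ) (x : Fin d → ℝ) (δ : ℝ), 0 < δ → δ ≤ 1 →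
          ∀ η : (Fin d → ℝ) → ℝ, Adm s r' η → |sPair s (g n) x δ η| ≤ C * δ ^ β) ∧
        Filter.Tendsto (fun n => ∫ y, f n y * g n y) Filter.atTop Filter.atTop := by
  set i0 : Fin d := ⟨0, hd⟩
  let bmp : ContDiffBump (0 : Fin d → ℝ) := ⟨1, 2, one_pos, one_lt_two⟩
  set χ : (Fin d → ℝ) → ℝ := fun y => bmp y with hχdef
  have hχ : ContDiff ℝ (⊤ : ℕ∞) χ := bmp.contDiff
  have hc : HasCompactSupport χ := bmp.hasCompactSupport
  have hreg : ∀ γ : ℝ, ∀ n : ℕ, ContDiff ℝ (⊤ : ℕ∞) (fun y : Fin d → ℝ =>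
      ((n : ℝ) + 1) ^ (-γ) * (χ y * Real.cos (((n : ℝ) + 1) ^ (s i0) * y i0))) ∧
      tsupport (fun y : Fin d → ℝ =>
      ((n : ℝ) + 1) ^ (-γ) * (χ y * Real.cos (((n : ℝ) + 1) ^ (s i0) * y i0))) ⊆ tsupport χ := by
    intro γ n
    constructor
    · refine contDiff_const.mul (hχ.mul (Real.contDiff_cos.comp ?_))
      fun_prop
    · refine closure_mono ?_
      intro y hy hcon
      exact hy (by simp [hcon])
  obtain ⟨C, hC⟩ := aux_main i0 s hs α hα r hr χ hχ hc
  obtain ⟨C', hC'⟩ := aux_main i0 s hs β hβ r' hr' χ hχ hc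
  refine ⟨tsupport χ, hc, fun n y =>
      ((n : ℝ) + 1) ^ (-α) * (χ y * Real.cos (((n : ℝ) + 1) ^ (s i0) * y i0)), fun n y =>
      ((n : ℝ) + 1) ^ (-β) * (χ y * Real.cos (((n : ℝ) + 1) ^ (s i0) * y i0)),
      hreg α, hreg β, ⟨C, fun n => hC _ (by simp)⟩, ⟨C', fun n => hC' _ (by simp)⟩, ?_⟩
  set Q : (Fin d → ℝ) → ℝ := fun y => χ y * χ y with hQ
  have hQs : ContDiff ℝ (⊤ : ℕ∞) Q := hχ.mul hχ
  have hQc : HasCompactSupport Q := hc.mul_right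
  obtain ⟨A, hA0, hA⟩ := aux_bdd Q hQs hQc 1
  have hQi : Integrable Q := hQs.continuous.integrable_of_hasCompactSupport hQc
  have hQpos : 0 < ∫ y, Q y := by
    refine hQs.continuous.integral_pos_of_hasCompactSupport_nonneg_nonzero hQc
      (fun y => mul_self_nonneg _) (x := 0) ?_
    have : χ 0 = 1 := bmp.one_of_mem_closedBall (by simp [bmp])
    simp [hQ, this]
  set J : ℕ → ℝ := fun n => ∫ y, Q y * Real.cos (2 * ((n : ℝ) + 1) ^ (s i0) * y i0 + 0) with hJ
  have hn1 : Filter.Tendsto (fun n : ℕ => (n : ℝ) + 1) Filter.atTop Filter.atTop :=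
    Filter.tendsto_atTop_add_const_right _ _ tendsto_natCast_atTop_atTop
  have hlam : Filter.Tendsto (fun n : ℕ => 2 * ((n : ℝ) + 1) ^ (s i0)) Filter.atTop Filter.atTop :=
    Filter.Tendsto.const_mul_atTop two_pos
      ((Filter.tendsto_pow_atTop (hs i0).ne').comp hn1)
  have hJ0 : Filter.Tendsto J Filter.atTop (nhds 0) := by
    refine squeeze_zero_norm (a := fun n : ℕ => A * volume.real (tsupport Q) /
      (2 * ((n : ℝ) + 1) ^ (s i0))) ?_ (Filter.Tendsto.div_atTop tendsto_const_nhds hlam)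
    intro n
    have := aux_osc i0 (tsupport Q) hQc A (2 * ((n : ℝ) + 1) ^ (s i0)) (by positivity) 1 Q
      (hQs.of_le (by exact_mod_cast le_top)) le_rfl (hA 1 le_rfl) 0
    rw [pow_one] at this
    exact this
  have heq : ∀ n : ℕ, (∫ y, ((n : ℝ) + 1) ^ (-α) * (χ y * Real.cos (((n : ℝ) + 1) ^ (s i0) * y i0)) *
      (((n : ℝ) + 1) ^ (-β) * (χ y * Real.cos (((n : ℝ) + 1) ^ (s i0) * y i0))))
      = ((n : ℝ) + 1) ^ (-(α + β)) * ((∫ y, Q y) / 2 + J n / 2) := by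
    intro n
    have hi2 : Integrable (fun y : Fin d → ℝ =>
        Q y * Real.cos (2 * ((n : ℝ) + 1) ^ (s i0) * y i0 + 0)) := by
      refine Continuous.integrable_of_hasCompactSupport ?_ hQc.mul_right
      have := hQs.continuous
      fun_prop
    simp only [hJ]
    rw [← integral_div, ← integral_div, ← integral_add (hQi.div_const 2) (hi2.div_const 2),
      ← integral_const_mul]
    congr 1
    ext y
    rw [neg_add, Real.rpow_add (by positivity), add_zero, mul_assoc 2, Real.cos_two_mul]
    simp only [hQ]
    ring
  simp only [heq]
  refine Filter.Tendsto.atTop_mul_pos (C := (∫ y, Q y) / 2) (by positivity)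
    ((tendsto_rpow_atTop (by linarith)).comp hn1) ?_
  simpa using (hJ0.div_const 2).const_add ((∫ y, Q y) / 2)
end
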